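/- arXiv:1912.06949 — 2 statements merged into one kernel-verified Lean document; each statement's English description precedes it below -/
import Mathlib

section
/- Let R = k[x,y,z] be the standard graded polynomial ring over a field k, and let I ⊆ R_+² be a homogeneous R_+-primary grade 3 Gorenstein ideal equal to the ideal Pf(M) of submaximal Pfaffians of a homogeneous alternating matrix M (of odd size, presenting I). If every entry of the i-th row of M is homogeneous of degree at least 2, then the trimmed ideal (Pf_j(M) : j ≠ i) + R_+ · Pf_i(M) is minimally generated by μ(I) + 2 elements and defines a ring of type 2 (i.e., dim_k Soc of the quotient equals 2). -/
open MvPolynomial Module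

noncomputable section

/-- The standard graded polynomial ring `k[x_1, …, x_n]` (each variable of degree 1). -/
abbrev MvP (n : ℕ) (k : Type) [Field k] := MvPolynomial (Fin n) k

variable {n : ℕ} {k : Type} [Field k]

/-- The irrelevant ideal `R₊ = (x_1, …, x_n)`. -/
def irrIdeal (n : ℕ) (k : Type) [Field k] : Ideal (MvP n k) :=
  Ideal.span (Set.range X)

/-- A homogeneous ideal (w.r.t. the standard grading). -/
def IsHomogIdeal (I : Ideal (MvP n k)) : Prop :=
  ∀ f ∈ I, ∀ j : ℕ, homogeneousComponent j f ∈ I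

/-- `gradeGE I m` : the ideal `I` contains an `R`-regular sequence of length `m`. -/
def gradeGE {R : Type} [CommRing R] (I : Ideal R) (m : ℕ) : Prop :=
  ∃ rs : List R, rs.length = m ∧ (∀ r ∈ rs, r ∈ I) ∧ RingTheory.Sequence.IsRegular R rs

/-- `hasGrade I m` : the grade (length of a maximal `R`-regular sequence contained in `I`)
is exactly `m`. -/
def hasGrade {R : Type} [CommRing R] (I : Ideal R) (m : ℕ) : Prop :=
  gradeGE I m ∧ ¬ gradeGE I (m + 1)

/-- `mu I` : the minimal number of generators of `I`. -/
def mu {R : Type} [CommRing R] (I : Ideal R) : ℕ :=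
  sInf {m | ∃ f : Fin m → R, Ideal.span (Set.range f) = I}

/-- The degree-`j` graded piece of `R/I` (the image of the degree-`j` forms). -/
def aDeg (I : Ideal (MvP n k)) (j : ℕ) : Submodule k (MvP n k ⧸ I) :=
  Submodule.map (Ideal.Quotient.mkₐ k I).toLinearMap (homogeneousSubmodule (Fin n) k j)

/-- The socle `(0 :_{R/I} R₊)` of `R/I`, as a `k`-subspace of `R/I`. -/
def socle (I : Ideal (MvP n k)) : Submodule k (MvP n k ⧸ I) where
  carrier := {a | ∀ i : Fin n, Ideal.Quotient.mk I (X i) * a = 0}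
  add_mem' := by intro a b ha hb i; rw [mul_add, ha i, hb i, add_zero]
  zero_mem' := by intro i; rw [mul_zero]
  smul_mem' := by intro c a ha i; rw [mul_smul_comm, ha i, smul_zero]

/-- `Soc(R/I) = k(-c)` : the socle is one–dimensional, concentrated in degree `c`.
(For an Artinian quotient this says exactly that `R/I` is Gorenstein with socle degree `c`.) -/
def SocleOne (I : Ideal (MvP n k)) (c : ℕ) : Prop :=
  finrank k (socle I) = 1 ∧ finrank k ↥(socle I ⊓ aDeg I c) = 1

/-- `Soc(R/I) = k(-a) ⊕ k(-b)` : the socle is two–dimensional, with one basis vector in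
degree `a` and one in degree `b`. -/
def SocleTwo (I : Ideal (MvP n k)) (a b : ℕ) : Prop :=
  finrank k (socle I) = 2 ∧
    finrank k ↥(socle I ⊓ aDeg I a) = 1 ∧ finrank k ↥(socle I ⊓ aDeg I b) = 1

/-- A standard graded Artinian algebra `A = R/I` with embedding dimension
`e = dim_k A₁`, top socle degree `s` (the largest `s` with `A_s = 𝔪^s ≠ 0`), and socle
polynomial `∑ cᵢ zⁱ` (where `cᵢ = dim_k (Soc A)ᵢ`) is compressed if
`dim_k Aᵢ = min { C(e-1+i, i), ∑_ℓ c_ℓ · C(e-1+ℓ-i, ℓ-i) }` for all `0 ≤ i ≤ s`. -/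
def IsCompressed (I : Ideal (MvP n k)) : Prop :=
  ∃ s : ℕ, aDeg I s ≠ ⊥ ∧ (∀ j, s < j → aDeg I j = ⊥) ∧
    ∀ i ≤ s,
      finrank k ↥(aDeg I i) =
        min (Nat.choose (finrank k ↥(aDeg I 1) - 1 + i) i)
          (∑ l ∈ Finset.Icc i s,
            finrank k ↥(socle I ⊓ aDeg I l) *
              Nat.choose (finrank k ↥(aDeg I 1) - 1 + (l - i)) (l - i))

/-- The image of `X i` in `R/I`. -/
def xq (I : Ideal (MvP n k)) (i : Fin n) : MvP n k ⧸ I :=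
  Ideal.Quotient.mk I (X i)

/-- The Pfaffian of a `2m × 2m` matrix (intended for alternating matrices), defined by
recursive expansion along the first row:
`pf(A) = ∑_j (-1)^j ⬝ A 0 (j+1) ⬝ pf(A with rows/columns 0 and j+1 removed)`. -/
def pfAux {R : Type} [CommRing R] :
    (m : ℕ) → Matrix (Fin (2 * m)) (Fin (2 * m)) R → R
  | 0, _ => 1
  | (m + 1), A =>
      ∑ j : Fin (2 * m + 1),
        (-1 : R) ^ (j : ℕ) * A 0 j.succ *
          pfAux m (A.submatrix (fun i : Fin (2 * m) => Fin.succ (j.succAbove i))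
            (fun i : Fin (2 * m) => Fin.succ (j.succAbove i)))

/-- `subPf M i` : the submaximal Pfaffian `Pf_i(M)` of a `(2m+1) × (2m+1)` (alternating)
matrix `M`: the Pfaffian of the matrix obtained by deleting the `i`-th row and column. -/
def subPf {R : Type} [CommRing R] {m : ℕ}
    (M : Matrix (Fin (2 * m + 1)) (Fin (2 * m + 1)) R) (i : Fin (2 * m + 1)) : R :=
  pfAux m (M.submatrix i.succAbove i.succAbove)

/-- The ideal `Pf(M)` of submaximal Pfaffians of `M`. -/
def pfIdeal {R : Type} [CommRing R] {m : ℕ}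
    (M : Matrix (Fin (2 * m + 1)) (Fin (2 * m + 1)) R) : Ideal R :=
  Ideal.span (Set.range (subPf M))

/-- A matrix is alternating: skew-symmetric with zero diagonal. -/
def IsAlternating {R : Type} [CommRing R] {m : ℕ} (M : Matrix (Fin m) (Fin m) R) : Prop :=
  M.transpose = -M ∧ ∀ i, M i i = 0

/-- The "trimmed" ideal `(Pf_j(M) : j ≠ i₀) + J · (Pf_{i₀}(M))`. -/
def trimPf {R : Type} [CommRing R] {m : ℕ}
    (M : Matrix (Fin (2 * m + 1)) (Fin (2 * m + 1)) R)
    (i₀ : Fin (2 * m + 1)) (J : Ideal R) : Ideal R :=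
  Ideal.span {p | ∃ j ≠ i₀, p = subPf M j} ⊔ J * Ideal.span {subPf M i₀}

section Wick

variable {R V : Type} [CommRing R] [AddCommGroup V] [Module R V]

/-- Contraction of a product of vectors by a linear form, expanded as an alternating sum. -/
theorem contractLeft_ιMulti (d : Module.Dual R V) :
    ∀ (r : ℕ) (v : Fin (r + 1) → V),
      CliffordAlgebra.contractLeft (Q := (0 : QuadraticForm R V)) d
          (ExteriorAlgebra.ιMulti R (r + 1) v) =
        ∑ j : Fin (r + 1), ((-1 : R) ^ (j : ℕ) * d (v j)) •
          ExteriorAlgebra.ιMulti R r (fun t => v (j.succAbove t))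
  | 0, v => by
      rw [ExteriorAlgebra.ιMulti_succ_apply]
      erw [CliffordAlgebra.contractLeft_ι_mul]
      simp [CliffordAlgebra.contractLeft_one]
  | r + 1, v => by
      rw [ExteriorAlgebra.ιMulti_succ_apply]
      erw [CliffordAlgebra.contractLeft_ι_mul]
      erw [contractLeft_ιMulti d r]
      conv_rhs => rw [Fin.sum_univ_succ]
      rw [Finset.mul_sum, sub_eq_add_neg, ← Finset.sum_neg_distrib]
      congr 1
      · simp [Matrix.vecTail, Function.comp_def]
      · refine Finset.sum_congr rfl fun j _ => ?_
        rw [ExteriorAlgebra.ιMulti_succ_apply]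
        simp only [Matrix.vecTail, Function.comp_def, Fin.succ_succAbove_zero,
          Fin.succ_succAbove_succ, Fin.val_succ, pow_succ, mul_neg, mul_one, neg_mul, neg_smul]
        erw [mul_smul_comm]

theorem neg_toQuadraticMap_of_isAlt {B : LinearMap.BilinForm R V} (hB : B.IsAlt) :
    (-B).toQuadraticMap = (0 : QuadraticForm R V) - 0 := by
  ext x
  simp [hB x]

/-- The Pfaffian of the Gram matrix of a family of vectors with respect to an alternating form,
as an alternating multilinear map of the family. -/
def gramPf {B : LinearMap.BilinForm R V} (hB : B.IsAlt) (r : ℕ) : V [⋀^Fin r]→ₗ[R] R :=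
  ((ExteriorAlgebra.algebraMapInv (R := R) (M := V)).toLinearMap ∘ₗ
    CliffordAlgebra.changeForm (neg_toQuadraticMap_of_isAlt hB)).compAlternatingMap
      (ExteriorAlgebra.ιMulti R r)

theorem gramPf_zero {B : LinearMap.BilinForm R V} (hB : B.IsAlt) (v : Fin 0 → V) :
    gramPf hB 0 v = 1 := by
  simp [gramPf]

theorem gramPf_succ_succ {B : LinearMap.BilinForm R V} (hB : B.IsAlt) (r : ℕ)
    (v : Fin (r + 2) → V) :
    gramPf hB (r + 2) v = ∑ j : Fin (r + 1), (-1 : R) ^ (j : ℕ) * B (v 0) (v j.succ) *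
      gramPf hB r (fun t => v (j.succAbove t).succ) := by
  simp only [gramPf, LinearMap.compAlternatingMap_apply, LinearMap.comp_apply]
  rw [ExteriorAlgebra.ιMulti_succ_apply]
  erw [CliffordAlgebra.changeForm_ι_mul]
  rw [← CliffordAlgebra.changeForm_contractLeft]
  erw [contractLeft_ιMulti]
  simp [map_sum, ExteriorAlgebra.algebraMapInv]
  rfl

theorem pfAux_submatrix {ι : Type} [Fintype ι] [DecidableEq ι] {A : Matrix ι ι R}
    (hA : (Matrix.toBilin' A).IsAlt) :
    ∀ (m : ℕ) (v : Fin (2 * m) → ι),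
      pfAux m (A.submatrix v v) = gramPf hA (2 * m) (fun t => Pi.single (v t) 1)
  | 0, v => (gramPf_zero hA _).symm
  | m + 1, v => by
      refine Eq.trans ?_ (gramPf_succ_succ hA (2 * m) (fun t => Pi.single (v t) 1)).symm
      simp only [pfAux]
      refine Finset.sum_congr rfl fun j _ => ?_
      rw [Matrix.toBilin'_single, Matrix.submatrix_submatrix, pfAux_submatrix hA m]
      rfl

end Wick

section Relations

variable {R : Type} [CommRing R]

theorem IsAlternating.isAlt {m : ℕ} {M : Matrix (Fin m) (Fin m) R} (hM : IsAlternating M) :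
    (Matrix.toBilin' M).IsAlt := by
  intro x
  have h : ∀ i j, M j i = -M i j := fun i j => congrFun (congrFun hM.1 i) j
  rw [Matrix.toBilin'_apply, ← Finset.sum_product' Finset.univ Finset.univ]
  refine Finset.sum_involution (fun a _ => (a.2, a.1)) (fun a _ => ?_) (fun a _ ha => ?_)
    (fun _ _ => by simp) (fun _ _ => rfl)
  · rw [h a.1 a.2]
    ring
  · intro hs
    have : a.2 = a.1 := congrArg Prod.fst hs
    rw [this, hM.2] at ha
    simp at ha

variable {n : ℕ} {M : Matrix (Fin (2 * n + 1)) (Fin (2 * n + 1)) R}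

/-- The rows of an alternating matrix of odd size are relations among its signed submaximal
Pfaffians. -/
theorem sum_mul_subPf_eq_zero (hM : IsAlternating M) (l : Fin (2 * n + 1)) :
    ∑ j, M l j * ((-1) ^ (j : ℕ) * subPf M j) = 0 := by
  let v : Fin (2 * n + 2) → Fin (2 * n + 1) → R :=
    Fin.cons (Pi.single l 1) (fun t => Pi.single t 1)
  have h0 : gramPf hM.isAlt (2 * n + 2) v = 0 :=
    (gramPf hM.isAlt (2 * n + 2)).map_eq_zero_of_eq v (i := 0) (j := l.succ) (by simp [v])
      (Fin.succ_ne_zero l).symm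
  rw [gramPf_succ_succ] at h0
  rw [← h0]
  refine Finset.sum_congr rfl fun j _ => ?_
  simp only [v, Fin.cons_zero, Fin.cons_succ, Matrix.toBilin'_single, subPf,
    pfAux_submatrix hM.isAlt]
  ring

theorem exists_mulVec_eq_subPf (hM : IsAlternating M) {j l : Fin (2 * n + 1)} (hlj : l ≠ j) :
    ∃ (t : Fin (2 * n + 1) → R) (x : R),
      M.mulVec t = Pi.single l (subPf M j) + Pi.single j x := by
  cases n with
  | zero => exact absurd (Subsingleton.elim (α := Fin 1) l j) hlj
  | succ m =>
    obtain ⟨r, rfl⟩ := Fin.exists_succAbove_eq hlj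
    let e : Fin (2 * m + 2) → Fin (2 * m + 3) := j.succAbove
    let w : Fin (2 * m + 1) → Fin (2 * m + 3) := fun s => e (r.succAbove s)
    let b : Fin (2 * m + 3) → Fin (2 * m + 3) → R := fun a => Pi.single a 1
    let φ := gramPf hM.isAlt (2 * m + 2)
    let ε : R := ((Equiv.Perm.sign r.cycleRange.symm : ℤ) : R)
    let t : Fin (2 * m + 3) → R := ∑ s : Fin (2 * m + 1),
      ((-1 : R) ^ (s : ℕ) * gramPf hM.isAlt (2 * m) (fun q => b (w (s.succAbove q)))) • b (w s)
    have ht : ∀ a, M.mulVec t a = φ (Fin.cons (b a) (fun s => b (w s))) := by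
      intro a
      simp only [φ, t]
      rw [gramPf_succ_succ]
      simp only [Matrix.mulVec_sum, Matrix.mulVec_smul, Finset.sum_apply, b, Fin.cons_zero,
        Fin.cons_succ, Matrix.toBilin'_single, Pi.smul_apply, Matrix.mulVec_single_one]
      refine Finset.sum_congr rfl fun s _ => ?_
      simp [Matrix.col]
      ring
    have hr : φ (Fin.cons (b (e r)) (fun s => b (w s))) = ε * subPf M j := by
      have : (Fin.cons (b (e r)) (fun s => b (w s)) : Fin (2 * m + 2) → _) =
          (fun s => b (e s)) ∘ r.cycleRange.symm := by
        exact Fin.cons_removeNth_eq_comp_cycleRange_symm (fun s => b (e s)) r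
      rw [this, AlternatingMap.map_perm, subPf, pfAux_submatrix hM.isAlt (m + 1)]
      simp [ε, Units.smul_def, φ, b, e]
      rfl
    have hε : ε * ε = 1 := by
      simp only [ε, ← Int.cast_mul, ← Units.val_mul, Int.units_mul_self]
      simp
    refine ⟨ε • t, ε * M.mulVec t j, ?_⟩
    ext a
    rw [Matrix.mulVec_smul]
    rcases eq_or_ne a j with rfl | haj
    · simp [hlj.symm]
    · obtain ⟨s, rfl⟩ := Fin.exists_succAbove_eq haj
      rcases eq_or_ne s r with rfl | hsr
      · simp only [Pi.smul_apply, ht, Pi.add_apply, Pi.single_eq_same, Pi.single_eq_of_ne haj,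
          smul_eq_mul, add_zero]
        erw [hr, ← mul_assoc, hε, one_mul]
      · obtain ⟨q, rfl⟩ := Fin.exists_succAbove_eq hsr
        have h0 : φ (Fin.cons (b (e (r.succAbove q))) (fun s => b (w s))) = 0 :=
          φ.map_eq_zero_of_eq _ (i := 0) (j := q.succ) (by simp [w]) (Fin.succ_ne_zero q).symm
        have hne : j.succAbove (r.succAbove q) ≠ j.succAbove r := fun h =>
          hsr (Fin.succAbove_right_injective h)
        simp only [Pi.smul_apply, ht, Pi.add_apply, Pi.single_eq_of_ne hne,
          Pi.single_eq_of_ne haj, smul_eq_mul, add_zero]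
        erw [h0, mul_zero]

end Relations

section Syzygies

variable {R : Type} [CommRing R]

theorem regular_triple_of_gradeGE {I : Ideal R} (h : gradeGE I 3) :
    ∃ a ∈ I, ∃ b ∈ I, ∃ d ∈ I, (∀ y, a * y = 0 → y = 0) ∧
      (∀ y, b * y ∈ Ideal.span {a} → y ∈ Ideal.span {a}) ∧
      (∀ y, d * y ∈ Ideal.span {a, b} → y ∈ Ideal.span {a, b}) := by
  obtain ⟨rs, hlen, hmem, hreg⟩ := h
  obtain ⟨a, b, d, rfl⟩ := List.length_eq_three.mp hlen
  have key := hreg.regular_mod_prev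
  have aux : ∀ (J : Ideal R) (r : R), IsSMulRegular (R ⧸ (J • ⊤ : Submodule R R)) r →
      ∀ y, r * y ∈ J → y ∈ J := by
    intro J r hr y hy
    have hJ : (J • ⊤ : Submodule R R) = J := by simp
    rw [hJ] at hr
    have := isSMulRegular_iff_right_eq_zero_of_smul |>.mp hr
      (Submodule.Quotient.mk y) (by
        rw [← Submodule.Quotient.mk_smul, Submodule.Quotient.mk_eq_zero]
        exact hy)
    exact (Submodule.Quotient.mk_eq_zero _).mp this
  refine ⟨a, hmem a (by simp), b, hmem b (by simp), d, hmem d (by simp), ?_, ?_, ?_⟩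
  · intro y hy
    simpa using aux _ _ (key 0 (by simp)) y (by simpa using hy)
  · have := aux _ _ (key 1 (by simp))
    simpa using this
  · have := aux _ _ (key 2 (by simp))
    simpa [Ideal.ofList, Set.insert_def] using this

/-- A complex `R → R^N → R^N → R` given by `p`, `M`, `pᵀ` with homology killed by an ideal
generated by the entries of `p` and of grade at least three is exact at the last `R^N`. -/
theorem mem_range_mulVec_of_gradeGE [IsDomain R] {N : ℕ} {M : Matrix (Fin N) (Fin N) R}
    {p : Fin N → R} {I : Ideal R} (hI : gradeGE I 3) (hp : p ≠ 0) (hMp : M.mulVec p = 0)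
    (hcoker : ∀ c, p ⬝ᵥ c = 0 → ∀ r ∈ I, ∃ v, M.mulVec v = r • c)
    (hker : ∀ u, M.mulVec u = 0 → ∀ r ∈ I, ∃ s : R, r • u = s • p)
    {c : Fin N → R} (hc : p ⬝ᵥ c = 0) : ∃ v, M.mulVec v = c := by
  obtain ⟨a, ha, b, hb, d, hd, hra, hrb, hrd⟩ := regular_triple_of_gradeGE hI
  have ha0 : a ≠ 0 := by
    rintro rfl
    exact one_ne_zero (hra 1 (by simp))
  obtain ⟨j, hj⟩ : ∃ j, p j ≠ 0 := by
    by_contra! h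
    exact hp (funext h)
  have hker' : ∀ u, M.mulVec u = 0 → ∃ s : R, u = s • p := by
    intro u hu
    obtain ⟨s, hs⟩ := hker u hu a ha
    obtain ⟨t, ht⟩ := hker u hu b hb
    have h1 : a * t = b * s := by
      refine mul_right_cancel₀ hj ?_
      have e1 := congrFun hs j
      have e2 := congrFun ht j
      simp only [Pi.smul_apply, smul_eq_mul] at e1 e2
      linear_combination b * e1 - a * e2
    obtain ⟨q, rfl⟩ := Ideal.mem_span_singleton'.mp
      (hrb s (Ideal.mem_span_singleton'.mpr ⟨t, by rw [← h1, mul_comm]⟩))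
    refine ⟨q, funext fun l => mul_left_cancel₀ ha0 ?_⟩
    have e1 := congrFun hs l
    simp only [Pi.smul_apply, smul_eq_mul] at e1 ⊢
    linear_combination e1
  obtain ⟨u, hu⟩ := hcoker c hc a ha
  obtain ⟨v, hv⟩ := hcoker c hc b hb
  obtain ⟨w, hw⟩ := hcoker c hc d hd
  have cross : ∀ (x y : R) (f g : Fin N → R), M.mulVec f = x • c → M.mulVec g = y • c →
      ∃ s : R, y • f - x • g = s • p := by
    intro x y f g hf hg
    refine hker' _ ?_
    rw [Matrix.mulVec_sub, Matrix.mulVec_smul, Matrix.mulVec_smul, hf, hg, smul_comm, sub_self]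
  obtain ⟨γ, hγ⟩ := cross a b u v hu hv
  obtain ⟨β, hβ⟩ := cross d a w u hw hu
  obtain ⟨α, hα⟩ := cross b d v w hv hw
  have hrel : d * γ = a * (-α) + b * (-β) := by
    refine mul_right_cancel₀ hj ?_
    have e1 := congrFun hγ j
    have e2 := congrFun hβ j
    have e3 := congrFun hα j
    simp only [Pi.smul_apply, Pi.sub_apply, smul_eq_mul] at e1 e2 e3
    linear_combination -d * e1 - b * e2 - a * e3
  obtain ⟨s, r, hsr⟩ := Ideal.mem_span_pair.mp
    (hrd γ (Ideal.mem_span_pair.mpr ⟨-α, -β, by rw [hrel]; ring⟩))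
  have hdiv : ∀ l, ∃ t, u l - r * p l = a * t := by
    intro l
    have e1 := congrFun hγ l
    simp only [Pi.smul_apply, Pi.sub_apply, smul_eq_mul] at e1
    obtain ⟨t, ht⟩ := Ideal.mem_span_singleton'.mp
      (hrb (u l - r * p l) (Ideal.mem_span_singleton'.mpr ⟨v l + s * p l, by
        linear_combination -e1 + p l * hsr⟩))
    exact ⟨t, by rw [← ht, mul_comm]⟩
  choose t ht using hdiv
  refine ⟨t, funext fun l => mul_left_cancel₀ ha0 ?_⟩
  have hat : a • t = u - r • p := by
    funext l
    simpa using (ht l).symm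
  have e := congrFun (congrArg M.mulVec hat) l
  rw [Matrix.mulVec_sub, Matrix.mulVec_smul, Matrix.mulVec_smul, hMp, hu, smul_zero, sub_zero] at e
  simpa using e

variable {n : ℕ} {M : Matrix (Fin (2 * n + 1)) (Fin (2 * n + 1)) R}

/-- The vector of signed submaximal Pfaffians. -/
def pfVec (M : Matrix (Fin (2 * n + 1)) (Fin (2 * n + 1)) R) : Fin (2 * n + 1) → R :=
  fun j => (-1) ^ (j : ℕ) * subPf M j

theorem mulVec_pfVec (hM : IsAlternating M) : M.mulVec (pfVec M) = 0 :=
  funext fun l => sum_mul_subPf_eq_zero hM l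

theorem dotProduct_mulVec_of_isAlternating {N : ℕ} {A : Matrix (Fin N) (Fin N) R}
    (hA : IsAlternating A) (x y : Fin N → R) : x ⬝ᵥ A.mulVec y = -(A.mulVec x ⬝ᵥ y) := by
  rw [Matrix.dotProduct_mulVec, ← Matrix.mulVec_transpose, hA.1, Matrix.neg_mulVec,
    neg_dotProduct]

theorem pfIdeal_eq_span_pfVec : pfIdeal M = Ideal.span (Set.range (pfVec M)) := by
  refine le_antisymm (Ideal.span_le.mpr ?_) (Ideal.span_le.mpr ?_)
  · rintro _ ⟨j, rfl⟩
    have h : subPf M j = (-1) ^ (j : ℕ) * pfVec M j := by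
      rw [pfVec, ← mul_assoc, ← mul_pow]
      simp
    rw [h]
    exact Ideal.mul_mem_left _ _ (Ideal.subset_span ⟨j, rfl⟩)
  · rintro _ ⟨j, rfl⟩
    exact Ideal.mul_mem_left _ _ (Ideal.subset_span ⟨j, rfl⟩)

variable [IsDomain R]

theorem exists_mulVec_eq_of_pfVec_ne_zero (hM : IsAlternating M) {j l : Fin (2 * n + 1)}
    (hlj : l ≠ j) (hj : pfVec M j ≠ 0) :
    ∃ t, M.mulVec t = Pi.single l (pfVec M j) - Pi.single j (pfVec M l) := by
  obtain ⟨t, x, ht⟩ := exists_mulVec_eq_subPf hM hlj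
  have h0 : pfVec M ⬝ᵥ M.mulVec t = 0 := by
    rw [dotProduct_mulVec_of_isAlternating hM, mulVec_pfVec hM, zero_dotProduct, neg_zero]
  rw [ht, dotProduct_add, dotProduct_single, dotProduct_single] at h0
  have hx : (-1) ^ (j : ℕ) * x = -pfVec M l := by
    refine mul_left_cancel₀ hj ?_
    simp only [pfVec] at h0 ⊢
    linear_combination (-1) ^ (j : ℕ) * h0
  refine ⟨(-1 : R) ^ (j : ℕ) • t, ?_⟩
  rw [Matrix.mulVec_smul, ht, smul_add, ← Pi.single_smul', ← Pi.single_smul', smul_eq_mul,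
    smul_eq_mul, hx, Pi.single_neg, ← sub_eq_add_neg]
  rfl

/-- The Koszul relations on the signed submaximal Pfaffians lie in the image of the matrix. -/
theorem exists_mulVec_eq_koszul (hM : IsAlternating M) (j l : Fin (2 * n + 1)) :
    ∃ t, M.mulVec t = Pi.single l (pfVec M j) - Pi.single j (pfVec M l) := by
  rcases eq_or_ne l j with rfl | hlj
  · exact ⟨0, by simp⟩
  by_cases hj : pfVec M j = 0
  · by_cases hl : pfVec M l = 0
    · exact ⟨0, by simp [hj, hl]⟩
    · obtain ⟨t, ht⟩ := exists_mulVec_eq_of_pfVec_ne_zero hM hlj.symm hl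
      exact ⟨-t, by rw [Matrix.mulVec_neg, ht, neg_sub]⟩
  · exact exists_mulVec_eq_of_pfVec_ne_zero hM hlj hj

theorem exists_mulVec_eq_smul (hM : IsAlternating M) {c : Fin (2 * n + 1) → R}
    (hc : pfVec M ⬝ᵥ c = 0) {r : R} (hr : r ∈ pfIdeal M) : ∃ v, M.mulVec v = r • c := by
  rw [pfIdeal_eq_span_pfVec] at hr
  induction hr using Submodule.span_induction with
  | mem x hx =>
    obtain ⟨j, rfl⟩ := hx
    choose t ht using exists_mulVec_eq_koszul hM j
    refine ⟨∑ l, c l • t l, ?_⟩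
    simp only [Matrix.mulVec_sum, Matrix.mulVec_smul, ht, smul_sub, Finset.sum_sub_distrib]
    funext q
    simp only [Pi.sub_apply, Finset.sum_apply, Pi.smul_apply, smul_eq_mul, Pi.single_apply,
      mul_ite, mul_zero]
    have h0 : ∑ l, c l * pfVec M l = 0 := by
      rw [← hc]
      exact Finset.sum_congr rfl fun _ _ => mul_comm _ _
    by_cases hq : q = j
    · simp [hq, h0, mul_comm]
    · simp [hq, mul_comm]
  | zero => exact ⟨0, by simp⟩
  | add x y _ _ hx hy =>
    obtain ⟨v, hv⟩ := hx
    obtain ⟨w, hw⟩ := hy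
    exact ⟨v + w, by rw [Matrix.mulVec_add, hv, hw, add_smul]⟩
  | smul s x _ hx =>
    obtain ⟨v, hv⟩ := hx
    exact ⟨s • v, by rw [Matrix.mulVec_smul, hv, smul_assoc]⟩

theorem exists_smul_eq_smul_pfVec (hM : IsAlternating M) {u : Fin (2 * n + 1) → R}
    (hu : M.mulVec u = 0) {r : R} (hr : r ∈ pfIdeal M) : ∃ s : R, r • u = s • pfVec M := by
  rw [pfIdeal_eq_span_pfVec] at hr
  induction hr using Submodule.span_induction with
  | mem x hx =>
    obtain ⟨j, rfl⟩ := hx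
    refine ⟨u j, funext fun l => ?_⟩
    obtain ⟨t, ht⟩ := exists_mulVec_eq_koszul hM j l
    have h0 : u ⬝ᵥ M.mulVec t = 0 := by
      rw [dotProduct_mulVec_of_isAlternating hM, hu, zero_dotProduct, neg_zero]
    rw [ht, dotProduct_sub, dotProduct_single, dotProduct_single] at h0
    simp only [Pi.smul_apply, smul_eq_mul]
    linear_combination h0
  | zero => exact ⟨0, by simp⟩
  | add x y _ _ hx hy =>
    obtain ⟨s, hs⟩ := hx
    obtain ⟨t, ht⟩ := hy
    exact ⟨s + t, by rw [add_smul, hs, ht, add_smul]⟩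
  | smul c x _ hx =>
    obtain ⟨s, hs⟩ := hx
    exact ⟨c • s, by rw [smul_assoc, hs, smul_assoc]⟩

/-- If the submaximal Pfaffians of an alternating matrix generate an ideal of grade at least
three, then every syzygy on them has its `i`-th coordinate in the ideal of the `i`-th row. -/
theorem coeff_mem_of_syzygy (hM : IsAlternating M) (hI : gradeGE (pfIdeal M) 3)
    {J : Ideal R} {i : Fin (2 * n + 1)} (hJ : ∀ j, M i j ∈ J) {c : Fin (2 * n + 1) → R}
    (hc : ∑ j, c j * subPf M j = 0) : c i ∈ J := by
  have hsq : ∀ j : Fin (2 * n + 1), ((-1 : R) ^ (j : ℕ)) * (-1) ^ (j : ℕ) = 1 := fun j => by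
    rw [← mul_pow]
    simp
  have hp : pfVec M ≠ 0 := by
    intro h
    obtain ⟨a, ha, -, -, -, -, hra, -⟩ := regular_triple_of_gradeGE hI
    rw [pfIdeal_eq_span_pfVec, h] at ha
    have ha0 : a = 0 := by simpa [Ideal.span_eq_bot] using ha
    exact one_ne_zero (hra 1 (by simp [ha0]))
  have hc' : pfVec M ⬝ᵥ (fun j => (-1) ^ (j : ℕ) * c j) = 0 := by
    rw [← hc]
    refine Finset.sum_congr rfl fun j _ => ?_
    rw [pfVec]
    linear_combination (c j * subPf M j) * hsq j
  obtain ⟨v, hv⟩ := mem_range_mulVec_of_gradeGE hI hp (mulVec_pfVec hM)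
    (fun c hc r hr => exists_mulVec_eq_smul hM hc hr)
    (fun u hu r hr => exists_smul_eq_smul_pfVec hM hu hr) hc'
  have hi : c i = (-1) ^ (i : ℕ) * ∑ j, M i j * v j := by
    have : ∑ j, M i j * v j = (-1) ^ (i : ℕ) * c i := congrFun hv i
    rw [this, ← mul_assoc, hsq, one_mul]
  rw [hi]
  exact J.mul_mem_left _ (J.sum_mem fun j _ => J.mul_mem_right _ (hJ j))

end Syzygies

section Generators

theorem irrIdeal_eq_idealOfVars : irrIdeal n k = idealOfVars (Fin n) k := rfl

theorem mem_irrIdeal_iff {p : MvP n k} : p ∈ irrIdeal n k ↔ constantCoeff p = 0 := by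
  rw [← pow_one (irrIdeal n k), irrIdeal_eq_idealOfVars, mem_pow_idealOfVars_iff']
  simp only [Nat.lt_one_iff, Finsupp.degree_eq_zero_iff, forall_eq, constantCoeff_eq]

theorem sub_C_mem_irrIdeal (p : MvP n k) : p - C (constantCoeff p) ∈ irrIdeal n k :=
  mem_irrIdeal_iff.mpr (by simp)

theorem X_mem_irrIdeal (l : Fin n) : (X l : MvP n k) ∈ irrIdeal n k :=
  Ideal.subset_span ⟨l, rfl⟩

theorem mem_irrIdeal_sq_of_isHomogeneous {p : MvP n k} {d : ℕ} (hd : 2 ≤ d)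
    (hp : p.IsHomogeneous d) : p ∈ irrIdeal n k ^ 2 := by
  rw [irrIdeal_eq_idealOfVars, mem_pow_idealOfVars_iff']
  intro x hx
  exact hp.coeff_eq_zero (by omega)

theorem coeff_single_eq_zero {p : MvP n k} (hp : p ∈ irrIdeal n k ^ 2) (l : Fin n) :
    coeff (Finsupp.single l 1) p = 0 :=
  (mem_pow_idealOfVars_iff' 2 p).mp hp _ (by simp)

theorem smul_mk (J : Ideal (MvP n k)) (a : k) (g : MvP n k) :
    a • Ideal.Quotient.mk J g = Ideal.Quotient.mk J (C a * g) := by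
  rw [← smul_eq_C_mul]
  rfl

theorem linearIndependent_mk_iff {ι : Type} [Fintype ι] {J : Ideal (MvP n k)} {e : ι → MvP n k} :
    LinearIndependent k (fun t => Ideal.Quotient.mk J (e t)) ↔
      ∀ a : ι → k, ∑ t, C (a t) * e t ∈ J → ∀ t, a t = 0 := by
  rw [Fintype.linearIndependent_iff]
  refine forall_congr' fun a => imp_congr_left ?_
  rw [← Ideal.Quotient.eq_zero_iff_mem, map_sum]
  simp only [smul_mk]

theorem card_le_of_linearIndependent {ι : Type} [Fintype ι] {J : Ideal (MvP n k)}
    {e : ι → MvP n k} (he : ∀ t, e t ∈ J)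
    (hind : LinearIndependent k (fun t => Ideal.Quotient.mk (irrIdeal n k * J) (e t)))
    {m : ℕ} {f : Fin m → MvP n k} (hf : Ideal.span (Set.range f) = J) : Fintype.card ι ≤ m := by
  have h : ∀ t, ∃ r : Fin m → MvP n k, ∑ s, r s * f s = e t := fun t => by
    have := he t
    rw [← hf] at this
    exact (Ideal.mem_span_range_iff_exists_fun).mp this
  choose r hr using h
  have hli : LinearIndependent k (fun t s => constantCoeff (r t s)) := by
    rw [Fintype.linearIndependent_iff]
    intro a ha
    refine linearIndependent_mk_iff.mp hind a ?_
    have hsum : ∑ t, C (a t) * e t = ∑ s, (∑ t, C (a t) * r t s) * f s := by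
      simp only [← hr, Finset.mul_sum, Finset.sum_mul]
      rw [Finset.sum_comm]
      exact Finset.sum_congr rfl fun _ _ => Finset.sum_congr rfl fun _ _ => by ring
    rw [hsum]
    refine Ideal.sum_mem _ fun s _ => Ideal.mul_mem_mul (mem_irrIdeal_iff.mpr ?_) ?_
    · simpa [map_sum] using congrFun ha s
    · rw [← hf]
      exact Ideal.subset_span ⟨s, rfl⟩
  simpa using hli.fintype_card_le_finrank

/-- A generating family that is linearly independent modulo `R₊ J` has `μ(J)` elements. -/
theorem mu_eq_card {ι : Type} [Fintype ι] {J : Ideal (MvP n k)} {e : ι → MvP n k}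
    (he : Ideal.span (Set.range e) = J)
    (hind : LinearIndependent k (fun t => Ideal.Quotient.mk (irrIdeal n k * J) (e t))) :
    mu J = Fintype.card ι := by
  have hmem : Fintype.card ι ∈ {m | ∃ f : Fin m → MvP n k, Ideal.span (Set.range f) = J} :=
    ⟨e ∘ (Fintype.equivFin ι).symm, by rw [(Fintype.equivFin ι).symm.surjective.range_comp, he]⟩
  refine le_antisymm (Nat.sInf_le hmem) ?_
  obtain ⟨f, hf⟩ := Nat.sInf_mem ⟨_, hmem⟩
  exact card_le_of_linearIndependent (fun t => he ▸ Ideal.subset_span ⟨t, rfl⟩) hind hf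

theorem homogeneousComponent_mul_mem {I L : Ideal (MvP n k)} (hI : IsHomogIdeal I) {d : ℕ}
    (hL : ∀ j < d, ∀ g ∈ I, g.IsHomogeneous j → g ∈ L) {w : MvP n k}
    (hw : w ∈ irrIdeal n k * I) : homogeneousComponent d w ∈ L := by
  refine Submodule.mul_induction_on hw (fun q hq u hu => ?_) fun x y hx hy => by
    rw [map_add]
    exact L.add_mem hx hy
  induction hq using Submodule.span_induction generalizing u with
  | mem x hx =>
    obtain ⟨l, rfl⟩ := hx
    rw [← sum_homogeneousComponent u, Finset.mul_sum, map_sum]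
    refine L.sum_mem fun j _ => ?_
    have hj := homogeneousComponent_isHomogeneous j u
    rw [homogeneousComponent_of_mem ((isHomogeneous_X k l).mul hj)]
    split_ifs with h
    · exact L.mul_mem_left _ (hL j (by omega) _ (hI u hu j) hj)
    · exact L.zero_mem
  | zero => simp
  | add x y _ _ hx hy =>
    rw [add_mul, map_add]
    exact L.add_mem (hx u hu) (hy u hu)
  | smul r x _ hx =>
    rw [smul_eq_mul, mul_comm r x, mul_assoc]
    exact hx _ (I.mul_mem_left r hu)

/-- A homogeneous ideal has a generating family that is a basis modulo `R₊ I`. -/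
theorem exists_minimal_generators {I : Ideal (MvP n k)} (hI : IsHomogIdeal I) :
    ∃ (m : ℕ) (h : Fin m → MvP n k), Ideal.span (Set.range h) = I ∧
      LinearIndependent k (fun t => Ideal.Quotient.mk (irrIdeal n k * I) (h t)) := by
  obtain ⟨q, f, hf⟩ := Submodule.fg_iff_exists_fin_generating_family.mp
    (IsNoetherian.noetherian I)
  let Q : ℕ → Prop := fun r => ∃ h : Fin r → MvP n k, (∀ t, h t ∈ I ∧ ∃ d, (h t).IsHomogeneous d) ∧
    LinearIndependent k (fun t => Ideal.Quotient.mk (irrIdeal n k * I) (h t))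
  have hQ : ∃ r, Q r ∧ ¬ Q (r + 1) := by
    by_contra! hcon
    have hall : ∀ r, Q r := fun r => by
      induction r with
      | zero => exact ⟨Fin.elim0, fun t => t.elim0, linearIndependent_empty_type⟩
      | succ r ih => exact hcon r ih
    obtain ⟨h, hh, hind⟩ := hall (q + 1)
    have := card_le_of_linearIndependent (fun t => (hh t).1) hind hf
    simp at this
  obtain ⟨r, ⟨h, hh, hind⟩, hmax⟩ := hQ
  refine ⟨r, h, ?_, hind⟩
  set L := Ideal.span (Set.range h) with hLdef
  have hhL : ∀ t, h t ∈ L := fun t => Ideal.subset_span ⟨t, rfl⟩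
  have hhom : ∀ d, ∀ g ∈ I, g.IsHomogeneous d → g ∈ L := by
    intro d
    induction d using Nat.strong_induction_on with
    | _ d ih =>
      intro g hg hgd
      have hspan : Ideal.Quotient.mk (irrIdeal n k * I) g ∈
          Submodule.span k (Set.range fun t => Ideal.Quotient.mk (irrIdeal n k * I) (h t)) := by
        by_contra hnot
        refine hmax ⟨Fin.cons g h, fun t => ?_, ?_⟩
        · refine Fin.cases ⟨hg, d, hgd⟩ (fun s => hh s) t
        · have hcons : (fun t => Ideal.Quotient.mk (irrIdeal n k * I)
              ((Fin.cons g h : Fin (r + 1) → MvP n k) t)) =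
              Fin.cons (Ideal.Quotient.mk (irrIdeal n k * I) g)
                (fun t => Ideal.Quotient.mk (irrIdeal n k * I) (h t)) :=
            funext fun t => Fin.cases rfl (fun _ => rfl) t
          rw [hcons]
          exact hind.finCons hnot
      obtain ⟨a, ha⟩ := (Submodule.mem_span_range_iff_exists_fun k).mp hspan
      have hw : g - ∑ t, C (a t) * h t ∈ irrIdeal n k * I := by
        rw [← Ideal.Quotient.eq_zero_iff_mem, map_sub, ← ha, map_sum, sub_eq_zero]
        simp only [smul_mk]
      have hc := homogeneousComponent_mul_mem hI ih hw
      rw [map_sub, homogeneousComponent_of_mem hgd, if_pos rfl, map_sum] at hc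
      rw [← sub_add_cancel g (∑ t, homogeneousComponent d (C (a t) * h t))]
      refine L.add_mem hc (L.sum_mem fun t _ => ?_)
      obtain ⟨j, hj⟩ := (hh t).2
      rw [homogeneousComponent_C_mul, homogeneousComponent_of_mem hj]
      split_ifs
      · exact L.mul_mem_left _ (hhL t)
      · simp
  refine le_antisymm (Ideal.span_le.mpr ?_) fun g hg => ?_
  · rintro _ ⟨t, rfl⟩
    exact (hh t).1
  · rw [← sum_homogeneousComponent g]
    exact L.sum_mem fun j _ => hhom j _ (hI g hg j) (homogeneousComponent_isHomogeneous j g)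

end Generators

section Trim

/-- The combinations of the `P j` whose `i`-th coefficient can be chosen in `J`. -/
def coeffIdeal {R : Type} [CommRing R] {N : ℕ} (P : Fin N → R) (i : Fin N) (J : Ideal R) :
    Ideal R where
  carrier := {g | ∃ c : Fin N → R, c i ∈ J ∧ ∑ j, c j * P j = g}
  add_mem' := by
    rintro _ _ ⟨c, hc, rfl⟩ ⟨d, hd, rfl⟩
    exact ⟨c + d, J.add_mem hc hd, by simp [add_mul, Finset.sum_add_distrib]⟩
  zero_mem' := ⟨0, J.zero_mem, by simp⟩
  smul_mem' := by
    rintro r _ ⟨c, hc, rfl⟩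
    exact ⟨r • c, J.mul_mem_left r hc, by simp [Finset.mul_sum, mul_assoc]⟩

section

variable {R : Type} [CommRing R] {N : ℕ} {P : Fin N → R} {i : Fin N}

theorem mem_coeffIdeal {J : Ideal R} {g : R} :
    g ∈ coeffIdeal P i J ↔ ∃ c : Fin N → R, c i ∈ J ∧ ∑ j, c j * P j = g := Iff.rfl

theorem coeffIdeal_top : coeffIdeal P i ⊤ = Ideal.span (Set.range P) := by
  ext g
  simp [mem_coeffIdeal, Ideal.mem_span_range_iff_exists_fun]

theorem coeffIdeal_mono {J K : Ideal R} (h : J ≤ K) : coeffIdeal P i J ≤ coeffIdeal P i K :=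
  fun _ ⟨c, hc, hg⟩ => ⟨c, h hc, hg⟩

theorem mul_coeffIdeal_le (J K : Ideal R) : J * coeffIdeal P i K ≤ coeffIdeal P i (J * K) := by
  rw [Ideal.mul_le]
  rintro r hr _ ⟨c, hc, rfl⟩
  exact ⟨r • c, Ideal.mul_mem_mul hr hc, by simp [Finset.mul_sum, mul_assoc]⟩

theorem mul_mem_coeffIdeal {J : Ideal R} {r : R} (hr : r ∈ J) : r * P i ∈ coeffIdeal P i J :=
  ⟨Pi.single i r, by simpa using hr, by simp [Pi.single_apply]⟩

theorem mul_mem_coeffIdeal_iff {J : Ideal R}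
    (hsyz : ∀ c : Fin N → R, ∑ j, c j * P j = 0 → c i ∈ J) {r : R} :
    r * P i ∈ coeffIdeal P i J ↔ r ∈ J := by
  refine ⟨?_, mul_mem_coeffIdeal⟩
  rintro ⟨c, hc, hg⟩
  have h := hsyz (c - Pi.single i r) (by
    simp [sub_mul, Finset.sum_sub_distrib, hg, Pi.single_apply])
  simpa using J.sub_mem hc h

theorem trimPf_eq_coeffIdeal {m : ℕ} (M : Matrix (Fin (2 * m + 1)) (Fin (2 * m + 1)) R)
    (i : Fin (2 * m + 1)) (J : Ideal R) : trimPf M i J = coeffIdeal (subPf M) i J := by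
  refine le_antisymm (sup_le (Ideal.span_le.mpr ?_) ?_) ?_
  · rintro _ ⟨j, hj, rfl⟩
    exact ⟨Pi.single j 1, by simp [Pi.single_eq_of_ne hj.symm], by simp [Pi.single_apply]⟩
  · rw [Ideal.mul_le]
    intro r hr s hs
    obtain ⟨a, rfl⟩ := Ideal.mem_span_singleton'.mp hs
    rw [← mul_assoc]
    exact mul_mem_coeffIdeal (J.mul_mem_right a hr)
  · rintro _ ⟨c, hc, rfl⟩
    refine Ideal.sum_mem _ fun j _ => ?_
    by_cases hj : j = i
    · subst hj
      exact Ideal.mem_sup_right (Ideal.mul_mem_mul hc (Ideal.mem_span_singleton_self _))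
    · exact Ideal.mem_sup_left (Ideal.mul_mem_left _ _ (Ideal.subset_span ⟨j, hj, rfl⟩))

end

variable {N : ℕ} {P : Fin N → MvP n k} {i : Fin N}

local notation "𝔪" => irrIdeal n k

theorem not_mem_coeffIdeal (hsyz : ∀ c : Fin N → MvP n k, ∑ j, c j * P j = 0 → c i ∈ 𝔪 ^ 2) :
    P i ∉ coeffIdeal P i 𝔪 := by
  have h : (1 : MvP n k) ∉ 𝔪 := by simp [mem_irrIdeal_iff]
  rwa [← one_mul (P i), mul_mem_coeffIdeal_iff fun c hc => Ideal.pow_le_self two_ne_zero (hsyz c hc)]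

theorem exists_sub_mem_coeffIdeal {g : MvP n k} (hg : g ∈ Ideal.span (Set.range P)) :
    ∃ β : k, g - C β * P i ∈ coeffIdeal P i 𝔪 := by
  rw [← coeffIdeal_top (i := i)] at hg
  obtain ⟨c, -, rfl⟩ := hg
  refine ⟨constantCoeff (c i), c - Pi.single i (C (constantCoeff (c i))), ?_, ?_⟩
  · simpa using sub_C_mem_irrIdeal (c i)
  · simp [sub_mul, Finset.sum_sub_distrib, Pi.single_apply]

theorem C_mul_mem_iff {J : Ideal (MvP n k)} {a : k} {g : MvP n k} (hg : g ∉ J) :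
    C a * g ∈ J ↔ a = 0 := by
  refine ⟨fun h => ?_, fun h => by simp [h]⟩
  by_contra ha
  refine hg ?_
  have := J.mul_mem_left (C a⁻¹) h
  rwa [← mul_assoc, ← C_mul, inv_mul_cancel₀ ha, C_1, one_mul] at this

theorem eq_zero_of_sum_C_mul_X_mem (a : Fin n → k) (h : ∑ l, C (a l) * X l ∈ 𝔪 ^ 2) (l : Fin n) :
    a l = 0 := by
  have := coeff_single_eq_zero h l
  classical
  simpa [coeff_sum, coeff_C_mul, coeff_X, Finsupp.single_left_inj] using this

theorem mu_coeffIdeal (hsyz : ∀ c : Fin N → MvP n k, ∑ j, c j * P j = 0 → c i ∈ 𝔪 ^ 2)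
    (hhom : IsHomogIdeal (Ideal.span (Set.range P))) :
    mu (coeffIdeal P i 𝔪) + 1 = mu (Ideal.span (Set.range P)) + n := by
  set I := Ideal.span (Set.range P) with hIdef
  set T := coeffIdeal P i 𝔪 with hTdef
  have hPT : P i ∉ T := not_mem_coeffIdeal hsyz
  have hPI : P i ∈ I := Ideal.subset_span ⟨i, rfl⟩
  have hTI : T ≤ I := by
    rw [hIdef, ← coeffIdeal_top (i := i)]
    exact coeffIdeal_mono le_top
  have hmT : 𝔪 * T ≤ coeffIdeal P i (𝔪 ^ 2) := by
    rw [pow_two]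
    exact mul_coeffIdeal_le _ _
  have hmI : 𝔪 * I ≤ T := by
    rw [hIdef, ← coeffIdeal_top (i := i)]
    refine (mul_coeffIdeal_le _ _).trans ?_
    rw [Ideal.mul_top]
  obtain ⟨m, h, hspan, hind⟩ := exists_minimal_generators hhom
  have hhI : ∀ t, h t ∈ I := fun t => hspan ▸ Ideal.subset_span ⟨t, rfl⟩
  choose β hβ using fun t => exists_sub_mem_coeffIdeal (i := i) (hhI t)
  obtain ⟨t₀, ht₀⟩ : ∃ t, β t ≠ 0 := by
    by_contra! hcon
    refine hPT ((?_ : I ≤ T) hPI)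
    rw [← hspan, Ideal.span_le]
    rintro _ ⟨t, rfl⟩
    simpa [hcon] using hβ t
  set w := h t₀ with hw
  have hwT : w ∉ T := by
    intro hwT
    have := T.sub_mem hwT (hβ t₀)
    rw [sub_sub_cancel, C_mul_mem_iff hPT] at this
    exact ht₀ this
  let g : {t // t ≠ t₀} → MvP n k := fun t => h t - C (β t / β t₀) * w
  have hgT : ∀ t, g t ∈ T := by
    intro t
    have h1 := T.sub_mem (hβ t) (T.mul_mem_left (C (β t / β t₀)) (hβ t₀))
    have h2 : h t - C (β t) * P i - C (β t / β t₀) * (h t₀ - C (β t₀) * P i) = g t := by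
      have h3 : (C (β t) : MvP n k) = C (β t / β t₀) * C (β t₀) := by
        rw [← C_mul, div_mul_cancel₀ _ ht₀]
      simp only [g, h3]
      ring
    rwa [h2] at h1
  let e : {t // t ≠ t₀} ⊕ Fin n → MvP n k := Sum.elim g (fun l => X l * w)
  have heT : ∀ s, e s ∈ T := by
    rintro (t | l)
    · exact hgT t
    · exact hmI (Ideal.mul_mem_mul (X_mem_irrIdeal l) (hhI t₀))
  have hespan : Ideal.span (Set.range e) = T := by
    set E := Ideal.span (Set.range e) with hE
    have hmE : 𝔪 ≤ E.colon {w} := by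
      rw [irrIdeal, Ideal.span_le]
      rintro _ ⟨l, rfl⟩
      rw [SetLike.mem_coe, Submodule.mem_colon_singleton, smul_eq_mul]
      exact Ideal.subset_span ⟨Sum.inr l, rfl⟩
    refine le_antisymm (Ideal.span_le.mpr ?_) fun x hx => ?_
    · rintro _ ⟨s, rfl⟩
      exact heT s
    · have hxI := hTI hx
      rw [← hspan] at hxI
      obtain ⟨r, rfl⟩ := Ideal.mem_span_range_iff_exists_fun.mp hxI
      have hdec : ∀ t, h t - C (β t / β t₀) * w ∈ E := by
        intro t
        by_cases htt : t = t₀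
        · subst htt
          simp [div_self ht₀, hw]
        · exact Ideal.subset_span ⟨Sum.inl ⟨t, htt⟩, rfl⟩
      have hET : E ≤ T := by
        rw [hE, Ideal.span_le]
        rintro _ ⟨s, rfl⟩
        exact heT s
      set y := ∑ t, r t * C (β t / β t₀) with hy
      have hxy : ∑ t, r t * h t - y * w ∈ E := by
        rw [hy, Finset.sum_mul, ← Finset.sum_sub_distrib]
        refine E.sum_mem fun t _ => ?_
        rw [mul_assoc, ← mul_sub]
        exact E.mul_mem_left _ (hdec t)
      have hyw : y * w ∈ T := by
        have := T.sub_mem hx (hET hxy)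
        rwa [sub_sub_cancel] at this
      have hy0 : constantCoeff y = 0 := by
        rw [← C_mul_mem_iff hwT]
        have := T.sub_mem hyw (hmI (Ideal.mul_mem_mul (sub_C_mem_irrIdeal y) (hhI t₀)))
        rwa [← sub_mul, sub_sub_cancel] at this
      have hyE : y * w ∈ E := by
        have := hmE (mem_irrIdeal_iff.mpr hy0)
        rwa [Submodule.mem_colon_singleton, smul_eq_mul] at this
      simpa using E.add_mem hxy hyE
  have heind : LinearIndependent k (fun s => Ideal.Quotient.mk (𝔪 * T) (e s)) := by
    rw [linearIndependent_mk_iff]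
    intro a ha
    rw [Fintype.sum_sum_type] at ha
    simp only [e, Sum.elim_inl, Sum.elim_inr] at ha
    have hl : ∀ t, a (Sum.inl t) = 0 := by
      have h1 : ∑ t, C (a (Sum.inl t)) * g t ∈ 𝔪 * I := by
        have h2 : ∑ l, C (a (Sum.inr l)) * (X l * w) ∈ 𝔪 * I :=
          Ideal.sum_mem _ fun l _ => Ideal.mul_mem_left _ _
            (Ideal.mul_mem_mul (X_mem_irrIdeal l) (hhI t₀))
        exact (Ideal.add_mem_iff_left _ h2).mp (Ideal.mul_mono_right hTI ha)
      let b : Fin m → k := fun t =>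
        if ht : t = t₀ then -∑ s : {t // t ≠ t₀}, a (Sum.inl s) * (β s / β t₀)
        else a (Sum.inl ⟨t, ht⟩)
      have hb : ∑ t, C (b t) * h t = ∑ t, C (a (Sum.inl t)) * g t := by
        have hne : ∑ t : {t // t ≠ t₀}, C (b t) * h t =
            ∑ t : {t // t ≠ t₀}, C (a (Sum.inl t)) * h t :=
          Finset.sum_congr rfl fun t _ => by simp [b, t.2]
        rw [Fintype.sum_eq_add_sum_subtype_ne _ t₀, hne]
        simp only [b, dif_pos, g, mul_sub, Finset.sum_sub_distrib, ← hw, map_neg, map_sum, map_mul,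
          neg_mul, Finset.sum_mul, mul_assoc]
        ring
      have hb0 := linearIndependent_mk_iff.mp hind b (hb ▸ h1)
      intro t
      have := hb0 t
      simpa [b, t.2] using this
    have hr : ∀ l, a (Sum.inr l) = 0 := by
      simp only [hl, map_zero, zero_mul, Finset.sum_const_zero, zero_add] at ha
      have h1 : ∑ l, C (a (Sum.inr l)) * (X l * (C (β t₀) * P i)) ∈ 𝔪 * T := by
        have h2 : ∑ l, C (a (Sum.inr l)) * (X l * (w - C (β t₀) * P i)) ∈ 𝔪 * T :=
          Ideal.sum_mem _ fun l _ => Ideal.mul_mem_left _ _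
            (Ideal.mul_mem_mul (X_mem_irrIdeal l) (hβ t₀))
        have h3 := Ideal.sub_mem _ ha h2
        rw [← Finset.sum_sub_distrib] at h3
        convert h3 using 2 with l
        ring
      have h4 : (∑ l, C (a (Sum.inr l) * β t₀) * X l) * P i ∈ coeffIdeal P i (𝔪 ^ 2) := by
        refine hmT ?_
        rw [Finset.sum_mul]
        convert h1 using 2 with l
        rw [C_mul]
        ring
      rw [mul_mem_coeffIdeal_iff hsyz] at h4
      intro l
      exact (mul_eq_zero.mp (eq_zero_of_sum_C_mul_X_mem _ h4 l)).resolve_right ht₀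
    rintro (t | l)
    · exact hl t
    · exact hr l
  rw [mu_eq_card hespan heind, mu_eq_card hspan hind]
  have hm : 0 < m := t₀.pos
  simp only [Fintype.card_sum, Fintype.card_fin, ne_eq, Fintype.card_subtype_compl,
    Fintype.card_unique]
  omega

/-- If the syzygies on `P` have their `i`-th coordinate in `R₊ ^ 2` and `R / (P)` has type one,
then the trimmed ideal defines a ring of type two. -/
theorem finrank_socle_coeffIdeal (hn : 2 ≤ n)
    (hsyz : ∀ c : Fin N → MvP n k, ∑ j, c j * P j = 0 → c i ∈ 𝔪 ^ 2)
    (hsoc : finrank k (socle (Ideal.span (Set.range P))) = 1) :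
    finrank k (socle (coeffIdeal P i 𝔪)) = 2 := by
  set I := Ideal.span (Set.range P) with hIdef
  set T := coeffIdeal P i 𝔪 with hTdef
  have hPT : P i ∉ T := not_mem_coeffIdeal hsyz
  have hPI : P i ∈ I := Ideal.subset_span ⟨i, rfl⟩
  have hTI : T ≤ I := by
    rw [hIdef, ← coeffIdeal_top (i := i)]
    exact coeffIdeal_mono le_top
  have hmem : ∀ (J : Ideal (MvP n k)) (g : MvP n k),
      Ideal.Quotient.mk J g ∈ socle J ↔ ∀ l, X l * g ∈ J := by
    intro J g
    refine forall_congr' fun l => ?_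
    rw [← map_mul, Ideal.Quotient.eq_zero_iff_mem]
  obtain ⟨⟨s', hs'⟩, hs0, hsgen⟩ := finrank_eq_one_iff'.mp hsoc
  obtain ⟨s, rfl⟩ := Ideal.Quotient.mk_surjective s'
  have hsI : s ∉ I := by
    intro h
    exact hs0 (Subtype.ext (Ideal.Quotient.eq_zero_iff_mem.mpr h))
  have hXs : ∀ l, ∃ c : Fin N → MvP n k, ∑ j, c j * P j = X l * s := fun l =>
    Ideal.mem_span_range_iff_exists_fun.mp ((hmem I s).mp hs' l)
  choose c hc using hXs
  have hci : ∀ l, c l i ∈ 𝔪 := by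
    intro l
    have : Nontrivial (Fin n) := Fin.nontrivial_iff_two_le.mpr hn
    obtain ⟨q, hq⟩ := exists_ne l
    have h1 := hsyz (fun j => X q * c l j - X l * c q j) (by
      simp only [sub_mul, Finset.sum_sub_distrib, mul_assoc, ← Finset.mul_sum, hc]
      ring)
    have h2 := coeff_single_eq_zero h1 q
    rw [coeff_sub, coeff_X_mul', coeff_X_mul'] at h2
    simpa [mem_irrIdeal_iff, constantCoeff_eq, hq, Finsupp.single_apply, hq.symm] using h2
  have hsT : Ideal.Quotient.mk T s ∈ socle T :=
    (hmem T s).mpr fun l => ⟨c l, hci l, hc l⟩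
  have hPsoc : Ideal.Quotient.mk T (P i) ∈ socle T :=
    (hmem T (P i)).mpr fun l => mul_mem_coeffIdeal (X_mem_irrIdeal l)
  have hli : LinearIndependent k (fun t => Ideal.Quotient.mk T (![s, P i] t)) := by
    rw [linearIndependent_mk_iff]
    intro a ha
    simp only [Fin.sum_univ_two, Matrix.cons_val_zero, Matrix.cons_val_one] at ha
    have h0 : a 0 = 0 := by
      rw [← C_mul_mem_iff hsI]
      exact (Ideal.add_mem_iff_left _ (I.mul_mem_left _ hPI)).mp (hTI ha)
    have h1 : a 1 = 0 := by
      rw [← C_mul_mem_iff hPT]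
      simpa [h0] using ha
    intro t
    fin_cases t
    · exact h0
    · exact h1
  have hspan : socle T = Submodule.span k (Set.range fun t => Ideal.Quotient.mk T (![s, P i] t)) := by
    refine le_antisymm (fun t' ht' => ?_) (Submodule.span_le.mpr ?_)
    · obtain ⟨t, rfl⟩ := Ideal.Quotient.mk_surjective t'
      have htI : Ideal.Quotient.mk I t ∈ socle I :=
        (hmem I t).mpr fun l => hTI ((hmem T t).mp ht' l)
      obtain ⟨α, hα⟩ := hsgen ⟨_, htI⟩
      have hα' : α • Ideal.Quotient.mk I s = Ideal.Quotient.mk I t := congrArg Subtype.val hα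
      rw [smul_mk, eq_comm, Ideal.Quotient.eq] at hα'
      obtain ⟨γ, hγ⟩ := exists_sub_mem_coeffIdeal (i := i) hα'
      rw [Submodule.mem_span_range_iff_exists_fun]
      refine ⟨![α, γ], ?_⟩
      simp only [Fin.sum_univ_two, Matrix.cons_val_zero, Matrix.cons_val_one, smul_mk]
      rw [← map_add, eq_comm, Ideal.Quotient.eq, ← sub_sub]
      exact hγ
    · rintro _ ⟨t, rfl⟩
      fin_cases t
      · exact hsT
      · exact hPsoc
  rw [hspan, finrank_span_eq_card hli, Fintype.card_fin]

end Trim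

/-- Let `R = k[x,y,z]` and let `I ⊆ R₊²` be a homogeneous
`R₊`-primary grade 3 Gorenstein ideal equal to the ideal `Pf(M)` of submaximal Pfaffians
of a homogeneous alternating matrix `M` of odd size (Gorenstein is encoded, for this
Artinian quotient, by a 1-dimensional socle).  If every entry of the `i`-th row of `M` is
homogeneous of degree at least 2, then the trimmed ideal
`(Pf_j(M) : j ≠ i) + R₊·Pf_i(M)` is minimally generated by `μ(I) + 2` elements and
defines a ring of type 2, i.e. the socle of its quotient is 2-dimensional. -/
theorem statement_10 {k : Type} [Field k] (n : ℕ)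
    (M : Matrix (Fin (2 * n + 1)) (Fin (2 * n + 1)) (MvP 3 k))
    (hM : IsAlternating M)
    (hMhom : ∀ a b, ∃ d : ℕ, (M a b).IsHomogeneous d)
    (I : Ideal (MvP 3 k)) (hI : I = pfIdeal M)
    (hIsub : I ≤ irrIdeal 3 k ^ 2) (hIhom : IsHomogIdeal I)
    (hprim : I.radical = irrIdeal 3 k)
    (hgr : hasGrade I 3) (hgor : finrank k (socle I) = 1)
    (i : Fin (2 * n + 1))
    (hrow : ∀ j, ∃ d : ℕ, 2 ≤ d ∧ (M i j).IsHomogeneous d) :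
    mu (trimPf M i (irrIdeal 3 k)) = mu I + 2 ∧
    finrank k (socle (trimPf M i (irrIdeal 3 k))) = 2 := by
  subst hI
  have hsyz : ∀ c : Fin (2 * n + 1) → MvP 3 k, ∑ j, c j * subPf M j = 0 →
      c i ∈ irrIdeal 3 k ^ 2 := fun c hc =>
    coeff_mem_of_syzygy hM hgr.1 (fun j => by
      obtain ⟨d, hd, h⟩ := hrow j
      exact mem_irrIdeal_sq_of_isHomogeneous hd h) hc
  rw [trimPf_eq_coeffIdeal]
  refine ⟨?_, finrank_socle_coeffIdeal (by norm_num) hsyz hgor⟩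
  have hmu := mu_coeffIdeal hsyz hIhom
  rw [pfIdeal]
  omega

end
end

section
/- Let R = k[x,y,z] be the standard graded polynomial ring over a field k, let I ⊂ R be a grade 3 homogeneous ideal defining a compressed Artinian ring with Soc(R/I) = k(−s) ⊕ k(−2s+1) for some s ≥ 3, and write I = I_1 ∩ I_2 with I_1, I_2 homogeneous grade 3 Gorenstein ideals with Soc(R/I_1) = k(−s) and Soc(R/I_2) = k(−2s+1). Then the ideal I_2 also defines a compressed ring. -/
open MvPolynomial Module

noncomputable section

variable {n : ℕ} {k : Type} [Field k]

theorem mk_mem_aDeg (I : Ideal (MvP n k)) {f : MvP n k} {j : ℕ} (hf : f.IsHomogeneous j) :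
    Ideal.Quotient.mk I f ∈ aDeg I j :=
  ⟨f, hf, rfl⟩

theorem mul_mem_aDeg {I : Ideal (MvP n k)} {a b : MvP n k ⧸ I} {i j : ℕ}
    (ha : a ∈ aDeg I i) (hb : b ∈ aDeg I j) : a * b ∈ aDeg I (i + j) := by
  obtain ⟨f, hf, rfl⟩ := ha
  obtain ⟨g, hg, rfl⟩ := hb
  exact ⟨f * g, IsHomogeneous.mul hf hg, map_mul (Ideal.Quotient.mk I) f g⟩

theorem aDeg_succ_eq_bot {I : Ideal (MvP n k)} {j : ℕ} (h : aDeg I j = ⊥) :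
    aDeg I (j + 1) = ⊥ := by
  rw [Submodule.eq_bot_iff]
  rintro _ ⟨f, hf, rfl⟩
  refine Ideal.Quotient.eq_zero_iff_mem.mpr ?_
  rw [f.as_sum]
  refine I.sum_mem fun m hm => ?_
  have hdeg : m.degree = j + 1 := by
    rw [Finsupp.degree_eq_weight_one]
    exact hf (mem_support_iff.mp hm)
  obtain ⟨t, ht⟩ : ∃ t, m t ≠ 0 := by
    by_contra! h0
    rw [show m = 0 from Finsupp.ext h0, map_zero] at hdeg
    omega
  have hm' : m = Finsupp.single t 1 + (m - Finsupp.single t 1) :=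
    (add_tsub_cancel_of_le (Finsupp.single_le_iff.mpr (Nat.one_le_iff_ne_zero.mpr ht))).symm
  have hdeg' : (m - Finsupp.single t 1).degree = j := by
    rw [hm', map_add, Finsupp.degree_single] at hdeg
    omega
  have hmem := mk_mem_aDeg I (isHomogeneous_monomial (coeff m f) hdeg')
  rw [h, Submodule.mem_bot, Ideal.Quotient.eq_zero_iff_mem] at hmem
  have hmul := I.mul_mem_left (X t) hmem
  rwa [X, monomial_mul, one_mul, ← hm'] at hmul

theorem iSupIndep_aDeg {I : Ideal (MvP n k)} (hI : IsHomogIdeal I) : iSupIndep (aDeg I) := by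
  intro i
  rw [Submodule.disjoint_def]
  rintro _ ⟨f, hf, rfl⟩ hx
  have hle : (⨆ j, ⨆ _ : j ≠ i, aDeg I j) ≤
      (LinearMap.ker (homogeneousComponent (R := k) (σ := Fin n) i)).map
        (Ideal.Quotient.mkₐ k I).toLinearMap := by
    refine iSup₂_le fun j hj => Submodule.map_mono fun g hg => ?_
    rw [LinearMap.mem_ker, homogeneousComponent_of_mem hg, if_neg hj.symm]
  obtain ⟨g, hg, hgf⟩ := hle hx
  have hmem : f - g ∈ I := Ideal.Quotient.eq.mp hgf.symm
  have hcomp := hI _ hmem i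
  rw [map_sub, LinearMap.mem_ker.mp hg, sub_zero, homogeneousComponent_of_mem hf,
    if_pos rfl] at hcomp
  exact Ideal.Quotient.eq_zero_iff_mem.mpr hcomp

theorem exists_aDeg_eq_bot {I : Ideal (MvP n k)} (hI : IsHomogIdeal I)
    [FiniteDimensional k (MvP n k ⧸ I)] : ∃ N, ∀ j, N ≤ j → aDeg I j = ⊥ := by
  have hfin := WellFoundedGT.finite_ne_bot_of_iSupIndep (iSupIndep_aDeg hI)
  obtain ⟨N, hN⟩ := hfin.bddAbove
  refine ⟨N + 1, fun j hj => ?_⟩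
  by_contra h
  have := hN h
  omega

theorem aDeg_le_socle {I : Ideal (MvP n k)} {c : ℕ} (h : aDeg I (c + 1) = ⊥) :
    aDeg I c ≤ socle I := by
  intro a ha i
  have := mul_mem_aDeg (mk_mem_aDeg I (isHomogeneous_X k i)) ha
  rwa [add_comm 1 c, h, Submodule.mem_bot] at this

/-- In a graded Artinian quotient whose socle vanishes outside degree `c`, every nonzero form has
a nonzero multiple in degree `c`. -/
theorem exists_mul_ne_zero {I : Ideal (MvP n k)} (hI : IsHomogIdeal I)
    [FiniteDimensional k (MvP n k ⧸ I)] {c : ℕ}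
    (hc : ∀ l, l ≠ c → socle I ⊓ aDeg I l = ⊥) {i : ℕ} {a : MvP n k ⧸ I}
    (ha : a ∈ aDeg I i) (ha0 : a ≠ 0) : ∃ j, i + j = c ∧ ∃ b ∈ aDeg I j, b * a ≠ 0 := by
  obtain ⟨N, hN⟩ := exists_aDeg_eq_bot hI
  induction hm : N - i generalizing i a with
  | zero =>
    have h : a ∈ aDeg I i := ha
    rw [hN i (by omega), Submodule.mem_bot] at h
    exact absurd h ha0
  | succ m ih =>
    by_cases hic : i = c
    · exact ⟨0, hic, 1, mk_mem_aDeg I (isHomogeneous_one _ _), by rwa [one_mul]⟩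
    · have hns : a ∉ socle I := fun hs => ha0 <| by
        have : a ∈ socle I ⊓ aDeg I i := ⟨hs, ha⟩
        rwa [hc i hic, Submodule.mem_bot] at this
      obtain ⟨t, ht⟩ : ∃ t, Ideal.Quotient.mk I (X t) * a ≠ 0 := by
        by_contra! h
        exact hns h
      obtain ⟨j, hj, b, hb, hb0⟩ :=
        ih (mul_mem_aDeg (mk_mem_aDeg I (isHomogeneous_X k t)) ha) ht (by omega)
      refine ⟨j + 1, by omega, b * Ideal.Quotient.mk I (X t),
        mul_mem_aDeg hb (mk_mem_aDeg I (isHomogeneous_X k t)), by rwa [mul_assoc]⟩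

theorem socle_inf_aDeg_eq_bot {I : Ideal (MvP n k)} (hI : IsHomogIdeal I) {T : Set ℕ}
    (hT : socle I ≤ ⨆ j ∈ T, aDeg I j) {l : ℕ} (hl : l ∉ T) : socle I ⊓ aDeg I l = ⊥ := by
  have h : Disjoint (aDeg I l) (⨆ j ∈ T, aDeg I j) := (iSupIndep_aDeg hI).disjoint_biSup hl
  exact (h.mono_right hT).symm.eq_bot

theorem SocleOne.inf_aDeg_eq_bot {I : Ideal (MvP n k)} (hI : IsHomogIdeal I)
    [FiniteDimensional k (MvP n k ⧸ I)] {c : ℕ} (h : SocleOne I c) {l : ℕ} (hl : l ≠ c) :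
    socle I ⊓ aDeg I l = ⊥ := by
  have heq : socle I ⊓ aDeg I c = socle I :=
    Submodule.eq_of_le_of_finrank_eq inf_le_left (h.2.trans h.1.symm)
  refine socle_inf_aDeg_eq_bot hI (T := {c}) ?_ hl
  simpa using inf_eq_left.mp heq

theorem SocleTwo.inf_aDeg_eq_bot {I : Ideal (MvP n k)} (hI : IsHomogIdeal I)
    [FiniteDimensional k (MvP n k ⧸ I)] {a b : ℕ} (hab : a ≠ b) (h : SocleTwo I a b) {l : ℕ}
    (hla : l ≠ a) (hlb : l ≠ b) : socle I ⊓ aDeg I l = ⊥ := by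
  have hdisj : Disjoint (socle I ⊓ aDeg I a) (socle I ⊓ aDeg I b) :=
    ((iSupIndep_aDeg hI).pairwiseDisjoint hab).mono inf_le_right inf_le_right
  have hrank := Submodule.finrank_sup_add_finrank_inf_eq (socle I ⊓ aDeg I a) (socle I ⊓ aDeg I b)
  rw [hdisj.eq_bot, finrank_bot, h.2.1, h.2.2] at hrank
  have heq : (socle I ⊓ aDeg I a) ⊔ (socle I ⊓ aDeg I b) = socle I :=
    Submodule.eq_of_le_of_finrank_eq (sup_le inf_le_left inf_le_left)
      (by rw [h.1]; omega)
  refine socle_inf_aDeg_eq_bot hI (T := {a, b}) ?_ (by simp [hla, hlb])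
  rw [iSup_pair]
  exact heq.ge.trans (sup_le_sup inf_le_right inf_le_right)

theorem SocleOne.aDeg_eq_bot {I : Ideal (MvP n k)} (hI : IsHomogIdeal I)
    [FiniteDimensional k (MvP n k ⧸ I)] {c : ℕ} (h : SocleOne I c) {j : ℕ} (hj : c < j) :
    aDeg I j = ⊥ := by
  rw [Submodule.eq_bot_iff]
  intro a ha
  by_contra ha0
  obtain ⟨t, ht, -⟩ := exists_mul_ne_zero hI (fun _ hl => h.inf_aDeg_eq_bot hI hl) ha ha0
  omega

theorem SocleOne.finrank_aDeg {I : Ideal (MvP n k)} (hI : IsHomogIdeal I)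
    [FiniteDimensional k (MvP n k ⧸ I)] {c : ℕ} (h : SocleOne I c) :
    finrank k (aDeg I c) = 1 := by
  have := h.2
  rwa [inf_eq_right.mpr (aDeg_le_socle (h.aDeg_eq_bot hI c.lt_succ_self))] at this

theorem SocleOne.finrank_aDeg_le {I : Ideal (MvP n k)} (hI : IsHomogIdeal I)
    [FiniteDimensional k (MvP n k ⧸ I)] {c : ℕ} (h : SocleOne I c) {i j : ℕ} (hij : i + j = c) :
    finrank k (aDeg I i) ≤ finrank k (aDeg I j) := by
  obtain ⟨⟨v, hv⟩, hv0, hspan⟩ := finrank_eq_one_iff'.mp (h.finrank_aDeg hI)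
  have hv0' : v ≠ 0 := fun h0 => hv0 (Subtype.ext h0)
  obtain ⟨φ, hφ⟩ := Module.Projective.exists_dual_ne_zero k hv0'
  let B : aDeg I i →ₗ[k] Dual k (aDeg I j) :=
    ((LinearMap.mul k (MvP n k ⧸ I)).compr₂ φ).domRestrict₁₂ (aDeg I i) (aDeg I j)
  have hB : Function.Injective B := by
    rw [injective_iff_map_eq_zero]
    rintro ⟨a, ha⟩ hBa
    by_contra ha0
    obtain ⟨j', hj', b, hb, hb0⟩ := exists_mul_ne_zero hI
      (fun _ hl => h.inf_aDeg_eq_bot hI hl) ha (fun h0 => ha0 (Subtype.ext h0))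
    obtain rfl : j' = j := by omega
    have hab : a * b ∈ aDeg I c := hij ▸ mul_mem_aDeg ha hb
    obtain ⟨r, hr⟩ := hspan ⟨a * b, hab⟩
    have hr' : r • v = a * b := congrArg Subtype.val hr
    have hz : φ (a * b) = 0 := LinearMap.congr_fun hBa ⟨b, hb⟩
    rw [← hr', map_smul, smul_eq_mul] at hz
    rcases mul_eq_zero.mp hz with hz | hz
    · rw [mul_comm, ← hr', hz, zero_smul] at hb0
      exact hb0 rfl
    · exact hφ hz
  exact (LinearMap.finrank_le_finrank_of_injective hB).trans_eq Subspace.dual_finrank_eq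

/-- The Hilbert function of a graded Artinian Gorenstein quotient is symmetric. -/
theorem SocleOne.finrank_aDeg_eq {I : Ideal (MvP n k)} (hI : IsHomogIdeal I)
    [FiniteDimensional k (MvP n k ⧸ I)] {c : ℕ} (h : SocleOne I c) {i j : ℕ} (hij : i + j = c) :
    finrank k (aDeg I i) = finrank k (aDeg I j) :=
  (h.finrank_aDeg_le hI hij).antisymm (h.finrank_aDeg_le hI (by omega))

theorem finrank_aDeg_mono {I J : Ideal (MvP n k)} [FiniteDimensional k (MvP n k ⧸ I)]
    (hIJ : I ≤ J) (j : ℕ) : finrank k (aDeg J j) ≤ finrank k (aDeg I j) := by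
  have h : aDeg J j = (aDeg I j).map (Ideal.Quotient.factorₐ k hIJ).toLinearMap := by
    rw [aDeg, aDeg, ← Submodule.map_comp]
    rfl
  rw [h]
  exact Submodule.finrank_map_le _ _

theorem finrank_aDeg_inf_le (I J : Ideal (MvP n k)) [FiniteDimensional k (MvP n k ⧸ I)]
    [FiniteDimensional k (MvP n k ⧸ J)] (j : ℕ) :
    finrank k (aDeg (I ⊓ J) j) ≤ finrank k (aDeg I j) + finrank k (aDeg J j) := by
  let p : (MvP n k ⧸ I ⊓ J) →ₗ[k] (MvP n k ⧸ I) × (MvP n k ⧸ J) :=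
    (Ideal.Quotient.factorₐ k inf_le_left).toLinearMap.prod
      (Ideal.Quotient.factorₐ k inf_le_right).toLinearMap
  have hp : Function.Injective p := by
    rw [injective_iff_map_eq_zero]
    intro a ha
    obtain ⟨f, rfl⟩ := Ideal.Quotient.mk_surjective a
    exact Ideal.Quotient.eq_zero_iff_mem.mpr
      ⟨Ideal.Quotient.eq_zero_iff_mem.mp (congrArg Prod.fst ha),
        Ideal.Quotient.eq_zero_iff_mem.mp (congrArg Prod.snd ha)⟩
  have hle : (aDeg (I ⊓ J) j).map p ≤ (aDeg I j).prod (aDeg J j) := by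
    rintro _ ⟨_, ⟨f, hf, rfl⟩, rfl⟩
    exact ⟨⟨f, hf, rfl⟩, ⟨f, hf, rfl⟩⟩
  calc finrank k (aDeg (I ⊓ J) j) = finrank k ((aDeg (I ⊓ J) j).map p) :=
        (LinearEquiv.finrank_eq (Submodule.equivMapOfInjective p hp _))
    _ ≤ finrank k ((aDeg I j).prod (aDeg J j)) := Submodule.finrank_mono hle
    _ ≤ finrank k ((aDeg I j).map (LinearMap.inl k _ (MvP n k ⧸ J))) +
          finrank k ((aDeg J j).map (LinearMap.inr k (MvP n k ⧸ I) _)) := by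
        rw [LinearMap.prod_eq_sup_map]
        exact Submodule.finrank_add_le_finrank_add_finrank _ _
    _ ≤ _ := add_le_add (Submodule.finrank_map_le _ _) (Submodule.finrank_map_le _ _)

theorem choose_add_self_mono (d : ℕ) {a b : ℕ} (hab : a ≤ b) :
    (d + a).choose a ≤ (d + b).choose b := by
  rw [← Nat.choose_symm_add, ← Nat.choose_symm_add]
  exact Nat.choose_le_choose d (by omega)

/-- Let `R = k[x,y,z]`, let `I ⊂ R` be a grade 3 homogeneous ideal
defining a compressed Artinian ring with `Soc(R/I) = k(−s) ⊕ k(−2s+1)` for some `s ≥ 3`,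
and write `I = I₁ ∩ I₂` with `I₁, I₂` homogeneous grade 3 Gorenstein ideals with
`Soc(R/I₁) = k(−s)` and `Soc(R/I₂) = k(−2s+1)`.  Then `I₂` also defines a compressed
ring. -/
theorem statement_13 {k : Type} [Field k] (s : ℕ) (hs : 3 ≤ s) (I I₁ I₂ : Ideal (MvP 3 k))
    (hhom : IsHomogIdeal I) (hgr : hasGrade I 3)
    (hart : FiniteDimensional k (MvP 3 k ⧸ I))
    (hcomp : IsCompressed I) (hsoc : SocleTwo I s (2 * s - 1))
    (hdec : I = I₁ ⊓ I₂)
    (hhom1 : IsHomogIdeal I₁) (hgr1 : hasGrade I₁ 3)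
    (hart1 : FiniteDimensional k (MvP 3 k ⧸ I₁)) (hsoc1 : SocleOne I₁ s)
    (hhom2 : IsHomogIdeal I₂) (hgr2 : hasGrade I₂ 3)
    (hart2 : FiniteDimensional k (MvP 3 k ⧸ I₂)) (hsoc2 : SocleOne I₂ (2 * s - 1)) :
    IsCompressed I₂ := by
  have hne : ∀ l, l ≠ s → l ≠ 2 * s - 1 → socle I ⊓ aDeg I l = ⊥ := fun l h1 h2 =>
    hsoc.inf_aDeg_eq_bot hhom (by omega) h1 h2
  have hne2 : ∀ l, l ≠ 2 * s - 1 → socle I₂ ⊓ aDeg I₂ l = ⊥ := fun l h =>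
    hsoc2.inf_aDeg_eq_bot hhom2 h
  have hpos2 : aDeg I₂ (2 * s - 1) ≠ ⊥ := fun h0 => by
    have := hsoc2.finrank_aDeg hhom2
    rw [h0, finrank_bot] at this
    omega
  have hle1 : ∀ j, finrank k (aDeg I₂ j) ≤ finrank k (aDeg I j) := fun j =>
    finrank_aDeg_mono (hdec ▸ inf_le_right) j
  have hle2 : ∀ j, finrank k (aDeg I j) ≤ finrank k (aDeg I₁ j) + finrank k (aDeg I₂ j) :=
    fun j => hdec ▸ finrank_aDeg_inf_le I₁ I₂ j
  have hsymm : ∀ i j, i + j = 2 * s - 1 → finrank k (aDeg I₂ i) = finrank k (aDeg I₂ j) :=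
    fun i j hij => hsoc2.finrank_aDeg_eq hhom2 hij
  obtain ⟨t, ht, htop, hdim⟩ := hcomp
  obtain rfl : t = 2 * s - 1 := by
    have h1 : 2 * s - 1 ≤ t := by
      by_contra! hlt
      have := hsoc.2.2
      rw [htop _ hlt, inf_bot_eq, finrank_bot] at this
      omega
    by_contra h2
    have := hne t (by omega) h2
    rw [inf_eq_right.mpr (aDeg_le_socle (htop _ t.lt_succ_self))] at this
    exact ht this
  set d := finrank k (aDeg I 1) - 1 with hd
  have hbound : ∀ i ≤ 2 * s - 1, finrank k (aDeg I i) ≤ (d + i).choose i := fun i hi =>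
    (hdim i hi).trans_le (min_le_left _ _)
  have hhigh : ∀ i, s < i → i ≤ 2 * s - 1 →
      finrank k (aDeg I₂ i) = (d + (2 * s - 1 - i)).choose (2 * s - 1 - i) := by
    intro i hsi hi
    have hG : finrank k (aDeg I₂ i) = finrank k (aDeg I i) := by
      have h1 := hle1 i
      have h2 := hle2 i
      rw [hsoc1.aDeg_eq_bot hhom1 hsi, finrank_bot] at h2
      omega
    rw [hG, hdim i hi, Finset.sum_eq_single (2 * s - 1), hsoc.2.2, one_mul]
    · exact min_eq_right (choose_add_self_mono d (by omega))
    · intro l hl hl'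
      rw [Finset.mem_Icc] at hl
      rw [hne l (by omega) hl', finrank_bot, zero_mul]
    · simp [hi]
  have hmid : finrank k (aDeg I₂ s) = (d + (s - 1)).choose (s - 1) := by
    refine le_antisymm ?_ ?_
    · rw [hsymm s (s - 1) (by omega)]
      exact (hle1 _).trans (hbound _ (by omega))
    · rcases Nat.eq_zero_or_pos d with hd0 | hd0
      · rw [hd0, zero_add, Nat.choose_self, Nat.one_le_iff_ne_zero]
        intro h0
        have hbot : ∀ m, aDeg I₂ (s + m) = ⊥ := by
          intro m
          induction m with
          | zero => exact Submodule.finrank_eq_zero.mp h0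
          | succ m ih => exact aDeg_succ_eq_bot ih
        exact hpos2 (by simpa [show s + (s - 1) = 2 * s - 1 by omega] using hbot (s - 1))
      · have h1 := hle2 s
        rw [hsoc1.finrank_aDeg hhom1, hdim s (by omega)] at h1
        have hsum : (d + (s - 1)).choose (s - 1) + 1 ≤ ∑ l ∈ Finset.Icc s (2 * s - 1),
            finrank k ↥(socle I ⊓ aDeg I l) * (d + (l - s)).choose (l - s) := by
          have hsub : ({s, 2 * s - 1} : Finset ℕ) ⊆ Finset.Icc s (2 * s - 1) := by
            intro l hl
            simp only [Finset.mem_insert, Finset.mem_singleton] at hl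
            rw [Finset.mem_Icc]
            omega
          refine le_trans (le_of_eq ?_) (Finset.sum_le_sum_of_subset hsub)
          rw [Finset.sum_pair (by omega), hsoc.2.1, hsoc.2.2,
            show 2 * s - 1 - s = s - 1 by omega]
          simp [add_comm]
        have hchoose : (d + (s - 1)).choose (s - 1) + 1 ≤ (d + s).choose s := by
          obtain ⟨r, rfl⟩ : ∃ r, s = r + 1 := ⟨s - 1, by omega⟩
          rw [← add_assoc, Nat.choose_succ_succ, Nat.add_sub_cancel]
          exact Nat.add_le_add_left (Nat.choose_pos (by omega)) _
        have := le_min hchoose hsum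
        omega
  have hup : ∀ i, s ≤ i → i ≤ 2 * s - 1 →
      finrank k (aDeg I₂ i) = (d + (2 * s - 1 - i)).choose (2 * s - 1 - i) := by
    intro i hsi hi
    rcases hsi.eq_or_lt with rfl | hlt
    · rw [hmid, show 2 * s - 1 - s = s - 1 by omega]
    · exact hhigh i hlt hi
  have hd2 : finrank k (aDeg I₂ 1) - 1 = d := by
    rw [hsymm 1 (2 * s - 2) (by omega), hup _ (by omega) (by omega),
      show 2 * s - 1 - (2 * s - 2) = 1 by omega, Nat.choose_one_right, Nat.add_sub_cancel]
  refine ⟨2 * s - 1, hpos2, fun j hj => hsoc2.aDeg_eq_bot hhom2 hj, fun i hi => ?_⟩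
  rw [hd2, Finset.sum_eq_single (2 * s - 1), hsoc2.2, one_mul]
  · rcases le_or_gt s i with hsi | hsi
    · rw [hup i hsi hi, min_eq_right (choose_add_self_mono d (by omega))]
    · rw [hsymm i (2 * s - 1 - i) (by omega), hup _ (by omega) (by omega),
        show 2 * s - 1 - (2 * s - 1 - i) = i by omega,
        min_eq_left (choose_add_self_mono d (by omega))]
  · intro l _ hl'
    rw [hne2 l hl', finrank_bot, zero_mul]
  · simp [hi]

end
end
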